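/- arXiv:2411.08484 — 2 statements merged into one kernel-verified Lean document; each statement's English description precedes it below -/
import Mathlib

section
/- The integral ∫₀¹ 1/((π² + (ln x)²)(1 + x)) dx equals 1/4 − 1/π² − (2/π²) · Σ_{k=1}^∞ ζ(2k) / ((2k−1) · 4^k). -/
open Real MeasureTheory

theorem HasSum.congr_terms {ι α : Type*} [AddCommMonoid α] [TopologicalSpace α] {f g : ι → α}
    {a b : α} (h : HasSum f a) (hfg : ∀ i, g i = f i) (hab : b = a) : HasSum g b := by
  rw [hab, funext hfg]
  exact h

theorem hasSum_coth_sub_one_div {t : ℝ} (ht : 0 < t) :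
    HasSum (fun n : ℕ ↦ 2 * t / (t ^ 2 + ((n + 1) * π) ^ 2))
      ((1 + exp (-(2 * t))) / (1 - exp (-(2 * t))) - 1 / t) := by
  have hπ : (π : ℂ) ≠ 0 := by exact_mod_cast pi_ne_zero
  have htc : (t : ℂ) ≠ 0 := by exact_mod_cast ht.ne'
  have hx : Complex.I * t / π ∈ Complex.integerComplement := by
    rintro ⟨m, hm⟩
    have h := congrArg Complex.im hm
    have : (Complex.I * t / π).im = t / π := by
      rw [Complex.div_ofReal_im]; simp
    rw [this] at h
    simp only [Complex.intCast_im] at h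
    exact (div_pos ht pi_pos).ne h
  have hs := (summable_cotTerm hx).hasSum
  have hval : (∑' n, cotTerm (Complex.I * t / π) n) = π * Complex.cot (π * (Complex.I * t / π)) -
      1 / (Complex.I * t / π) := (cot_series_rep' hx).symm
  rw [hval] at hs
  rw [← Complex.hasSum_ofReal]
  have hs' := hs.mul_left (Complex.I / π)
  have hE : Complex.exp (2 * Complex.I * (Complex.I * t)) = ((exp (-(2 * t)) : ℝ) : ℂ) := by
    push_cast
    congr 1
    linear_combination (2 * t : ℂ) * Complex.I_sq
  have hE1 : (1 : ℂ) - ((exp (-(2 * t)) : ℝ) : ℂ) ≠ 0 := by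
    have : exp (-(2 * t)) < 1 := Real.exp_zero ▸ exp_lt_exp.2 (by linarith)
    exact_mod_cast (sub_pos.2 this).ne'
  refine hs'.congr_terms (fun n ↦ ?_) ?_
  · rw [cotTerm_identity hx]
    have h1 : (t : ℂ) ^ 2 + ((n + 1) * π) ^ 2 ≠ 0 := by
      have : 0 < t ^ 2 + ((n + 1) * π) ^ 2 := by positivity
      exact_mod_cast this.ne'
    have h2 : (Complex.I * t / π + (n + 1)) * (Complex.I * t / π - (n + 1)) =
        -(((t : ℂ) ^ 2 + ((n + 1) * π) ^ 2) / π ^ 2) := by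
      field_simp
      linear_combination (t ^ 2 : ℂ) * Complex.I_sq
    rw [h2]
    push_cast
    field_simp
    linear_combination (1 / ((t : ℂ) ^ 2 + ((n + 1) * π) ^ 2)) * Complex.I_sq
  · rw [mul_div_cancel₀ _ hπ, Complex.cot_eq_exp_ratio, hE]
    push_cast at hE1 ⊢
    field_simp
    ring

theorem hasSum_tanh_half {t : ℝ} (ht : 0 < t) :
    HasSum (fun n : ℕ ↦ 4 * t / (t ^ 2 + ((2 * n + 1) * π) ^ 2))
      ((1 - exp (-t)) / (1 + exp (-t))) := by
  set f : ℕ → ℝ := fun n ↦ 4 * t / (t ^ 2 + ((n + 1) * π) ^ 2) with hf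
  have h1 : HasSum f (2 * ((1 + exp (-(2 * t))) / (1 - exp (-(2 * t))) - 1 / t)) := by
    refine ((hasSum_coth_sub_one_div ht).mul_left 2).congr_terms (fun n ↦ ?_) rfl
    simp only [hf]
    ring
  have h2 : HasSum (fun n ↦ f (2 * n + 1)) ((1 + exp (-t)) / (1 - exp (-t)) - 2 / t) := by
    convert hasSum_coth_sub_one_div (half_pos ht) using 1
    · funext n
      simp only [hf]
      push_cast
      rw [div_eq_div_iff (by positivity) (by positivity)]
      ring
    · rw [mul_div_cancel₀ _ two_ne_zero]
      field_simp
  have h3 : Summable (fun n ↦ f (2 * n)) :=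
    h1.summable.comp_injective (mul_right_injective₀ two_ne_zero)
  have h4 := (h3.hasSum.even_add_odd h2).unique h1
  have h5 := h3.hasSum
  convert h5 using 1
  · funext n
    simp [hf]
  · have hq : exp (-(2 * t)) = exp (-t) ^ 2 := by rw [← exp_nat_mul]; congr 1; push_cast; ring
    have hq1 : 1 - exp (-t) ≠ 0 := (sub_pos.2 (Real.exp_zero ▸ exp_lt_exp.2 (by linarith))).ne'
    have hq2 : 1 + exp (-t) ≠ 0 := by positivity
    have hq3 : 1 - exp (-t) ^ 2 ≠ 0 := by
      rw [show 1 - exp (-t) ^ 2 = (1 - exp (-t)) * (1 + exp (-t)) by ring]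
      exact mul_ne_zero hq1 hq2
    rw [hq] at h4
    rw [← sub_eq_iff_eq_add.2 h4.symm]
    field_simp
    ring

theorem hasSum_riemannZeta_re_even (k : ℕ) :
    HasSum (fun n : ℕ ↦ 1 / ((n : ℝ) + 1) ^ (2 * k + 2)) (riemannZeta (2 * (k + 1))).re := by
  have h := zeta_nat_eq_tsum_of_gt_one (k := 2 * k + 2) (by omega)
  have hs : Summable (fun n : ℕ ↦ 1 / (n : ℝ) ^ (2 * k + 2)) :=
    Real.summable_one_div_nat_pow.2 (by omega)
  have h' : riemannZeta (2 * (k + 1)) = ((∑' n : ℕ, 1 / (n : ℝ) ^ (2 * k + 2) : ℝ) : ℂ) := by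
    rw [show (2 * ((k : ℂ) + 1)) = ((2 * k + 2 : ℕ) : ℂ) by push_cast; ring, h]
    push_cast
    rfl
  rw [h', Complex.ofReal_re]
  have h2 := (hasSum_nat_add_iff' (f := fun n : ℕ ↦ 1 / (n : ℝ) ^ (2 * k + 2)) 1).2 hs.hasSum
  simpa using h2

theorem summable_one_div_odd_mul_even_pow :
    Summable (Function.uncurry fun n k : ℕ ↦
      1 / ((2 * (k : ℝ) + 1) * (2 * ((n : ℝ) + 1)) ^ (2 * k + 2))) := by
  have h1 : Summable (fun n : ℕ ↦ 1 / ((n : ℝ) + 1) ^ 2) := by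
    simpa using (summable_nat_add_iff 1).2 (Real.summable_one_div_nat_pow.2 one_lt_two)
  have h2 : Summable (fun k : ℕ ↦ (1 / 4 : ℝ) ^ k) :=
    summable_geometric_of_lt_one (by norm_num) (by norm_num)
  refine Summable.of_nonneg_of_le ?_ ?_
    (h1.mul_of_nonneg h2 (fun n ↦ by positivity) (fun n ↦ by positivity))
  · rintro ⟨n, k⟩
    simp only [Function.uncurry]
    positivity
  · rintro ⟨n, k⟩
    simp only [Function.uncurry]
    have ha : (1:ℝ) ≤ 2 * k + 1 := by linarith [(Nat.cast_nonneg k : (0:ℝ) ≤ k)]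
    have hb : ((n : ℝ) + 1) ^ 2 * 4 ^ k ≤ (2 * ((n : ℝ) + 1)) ^ (2 * k + 2) := by
      have hn : (1:ℝ) ≤ n + 1 := by linarith [(Nat.cast_nonneg n : (0:ℝ) ≤ n)]
      rw [mul_pow, pow_add, pow_mul, pow_add ((n:ℝ) + 1)]
      have : (1:ℝ) ≤ ((n : ℝ) + 1) ^ (2 * k) := one_le_pow₀ hn
      have h3 : (0:ℝ) ≤ 4 ^ k * ((n : ℝ) + 1) ^ 2 := by positivity
      norm_num
      nlinarith
    rw [one_div_pow, one_div_mul_one_div]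
    apply one_div_le_one_div_of_le (by positivity)
    calc _ ≤ _ := hb
      _ ≤ _ := le_mul_of_one_le_left (by positivity) ha

theorem hasSum_artanh_one_div_even (n : ℕ) :
    HasSum (fun k : ℕ ↦ 1 / ((2 * (k : ℝ) + 1) * (2 * ((n : ℝ) + 1)) ^ (2 * k + 2)))
      ((log (2 * n + 3) - log (2 * n + 1)) / (4 * (n + 1))) := by
  have hn : (0:ℝ) ≤ n := Nat.cast_nonneg n
  have hx : |1 / (2 * ((n : ℝ) + 1))| < 1 := by
    rw [abs_of_pos (by positivity), div_lt_one (by positivity)]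
    linarith
  refine ((hasSum_log_sub_log_of_abs_lt_one hx).mul_left (1 / (4 * ((n : ℝ) + 1)))).congr_terms
    (fun k ↦ ?_) ?_
  · rw [one_div_pow, show 2 * k + 2 = (2 * k + 1) + 1 from rfl, pow_succ _ (2 * k + 1)]
    field_simp
    ring
  · have e1 : 1 + 1 / (2 * ((n : ℝ) + 1)) = (2 * n + 3) / (2 * (n + 1)) := by
      field_simp; ring
    have e2 : 1 - 1 / (2 * ((n : ℝ) + 1)) = (2 * n + 1) / (2 * (n + 1)) := by
      field_simp; ring
    rw [e1, e2, log_div (by positivity) (by positivity), log_div (by positivity) (by positivity)]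
    ring

theorem hasSum_log_odd_div :
    HasSum (fun n : ℕ ↦ log (2 * n + 3) / (4 * (n + 1) * (n + 2)))
      (∑' k : ℕ, (riemannZeta (2 * (k + 1))).re / ((2 * ((k : ℝ) + 1) - 1) * 4 ^ (k + 1))) := by
  have hS := summable_one_div_odd_mul_even_pow
  have h1 : HasSum (fun n : ℕ ↦ (log (2 * n + 3) - log (2 * n + 1)) / (4 * ((n : ℝ) + 1)))
      (∑' k : ℕ, (riemannZeta (2 * (k + 1))).re / ((2 * ((k : ℝ) + 1) - 1) * 4 ^ (k + 1))) := by
    have h := hS.hasSum.prod_fiberwise (fun n ↦ hasSum_artanh_one_div_even n)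
    convert h using 1
    rw [hS.tsum_prod]
    simp only [Function.uncurry_apply_pair]
    rw [hS.tsum_comm.symm]
    refine tsum_congr fun k ↦ ?_
    rw [((hasSum_riemannZeta_re_even k).div_const
      ((2 * ((k : ℝ) + 1) - 1) * 4 ^ (k + 1))).tsum_eq.symm]
    refine tsum_congr fun n ↦ ?_
    rw [mul_pow, show (2:ℝ) ^ (2 * k + 2) = 4 ^ (k + 1) by
      rw [show 2 * k + 2 = 2 * (k + 1) by ring, pow_mul]; norm_num, div_div]
    congr 1
    ring
  rw [hasSum_iff_tendsto_nat_of_nonneg fun n ↦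
    div_nonneg (log_nonneg (by linarith [(Nat.cast_nonneg n : (0:ℝ) ≤ n)])) (by positivity)]
  have hpart : ∀ N : ℕ, ∑ n ∈ Finset.range N, log (2 * n + 3) / (4 * ((n : ℝ) + 1) * (n + 2)) =
      ∑ n ∈ Finset.range N, (log (2 * n + 3) - log (2 * n + 1)) / (4 * ((n : ℝ) + 1)) -
        log (2 * N + 1) / (4 * (N + 1)) := by
    intro N
    induction N with
    | zero => simp
    | succ N ih =>
      rw [Finset.sum_range_succ, Finset.sum_range_succ, ih]
      push_cast
      rw [show (2 * ((N : ℝ) + 1) + 1) = 2 * N + 3 by ring]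
      field_simp
      ring
  simp_rw [hpart]
  have hlim : Filter.Tendsto (fun N : ℕ ↦ log (2 * N + 1) / (4 * ((N : ℝ) + 1)))
      Filter.atTop (nhds 0) := by
    have hcast : Filter.Tendsto (fun N : ℕ ↦ 2 * (N : ℝ) + 1) Filter.atTop Filter.atTop :=
      Filter.tendsto_atTop_add_const_right _ _
        (tendsto_natCast_atTop_atTop.const_mul_atTop two_pos)
    have h := (Real.isLittleO_log_id_atTop.tendsto_div_nhds_zero).comp hcast
    refine squeeze_zero (fun N ↦ div_nonneg (log_nonneg ?_) (by positivity)) (fun N ↦ ?_) h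
    · linarith [(Nat.cast_nonneg N : (0:ℝ) ≤ N)]
    · have hN : (0:ℝ) ≤ N := Nat.cast_nonneg N
      exact div_le_div_of_nonneg_left (log_nonneg (by linarith)) (by simp only [id]; positivity)
        (by simp only [id]; linarith)
  simpa using h1.tendsto_sum_nat.sub hlim

theorem integrableOn_and_integral_one_div_sq_add_sq {a : ℝ} (ha : 0 < a) :
    IntegrableOn (fun t : ℝ ↦ 1 / (a ^ 2 + t ^ 2)) (Set.Ioi 0) ∧
      ∫ t in Set.Ioi (0 : ℝ), 1 / (a ^ 2 + t ^ 2) = π / (2 * a) := by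
  have hd : ∀ t ∈ Set.Ici (0 : ℝ),
      HasDerivAt (fun t ↦ arctan (t / a) / a) (1 / (a ^ 2 + t ^ 2)) t := by
    intro t _
    refine ((((hasDerivAt_id t).div_const a).arctan).div_const a).congr_deriv ?_
    simp only [id]
    field_simp
  have hn : ∀ t ∈ Set.Ioi (0 : ℝ), 0 ≤ 1 / (a ^ 2 + t ^ 2) := fun t _ ↦ by positivity
  have hl : Filter.Tendsto (fun t ↦ arctan (t / a) / a) Filter.atTop (nhds (π / 2 / a)) :=
    ((tendsto_nhds_of_tendsto_nhdsWithin tendsto_arctan_atTop).comp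
      (Filter.tendsto_id.atTop_div_const ha)).div_const a
  refine ⟨integrableOn_Ioi_deriv_of_nonneg' hd hn hl, ?_⟩
  rw [integral_Ioi_of_hasDerivAt_of_nonneg' hd hn hl]
  simp [div_div]

theorem integrableOn_and_integral_div_sq_add_sq_sq {a : ℝ} (ha : 0 < a) :
    IntegrableOn (fun t : ℝ ↦ 4 * t / (t ^ 2 + a ^ 2) * (1 / (a ^ 2 + t ^ 2))) (Set.Ioi 0) ∧
      ∫ t in Set.Ioi (0 : ℝ), 4 * t / (t ^ 2 + a ^ 2) * (1 / (a ^ 2 + t ^ 2)) = 2 / a ^ 2 := by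
  have hd : ∀ t ∈ Set.Ici (0 : ℝ), HasDerivAt (fun t ↦ -2 / (t ^ 2 + a ^ 2))
      (4 * t / (t ^ 2 + a ^ 2) * (1 / (a ^ 2 + t ^ 2))) t := by
    intro t _
    have hne : t ^ 2 + a ^ 2 ≠ 0 := by positivity
    refine ((((hasDerivAt_pow 2 t).add_const (a ^ 2)).fun_inv hne).const_mul (-2)).congr_deriv ?_
    rw [add_comm (a ^ 2)]
    field_simp
    norm_num
    ring
  have hn : ∀ t ∈ Set.Ioi (0 : ℝ), 0 ≤ 4 * t / (t ^ 2 + a ^ 2) * (1 / (a ^ 2 + t ^ 2)) := by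
    intro t ht
    have : 0 < t := ht
    positivity
  have hl : Filter.Tendsto (fun t ↦ -2 / (t ^ 2 + a ^ 2)) Filter.atTop (nhds 0) :=
    (Filter.tendsto_atTop_add_const_right _ _
      (Filter.tendsto_pow_atTop two_ne_zero)).const_div_atTop _
  refine ⟨integrableOn_Ioi_deriv_of_nonneg' hd hn hl, ?_⟩
  rw [integral_Ioi_of_hasDerivAt_of_nonneg' hd hn hl]
  simp [neg_div]

theorem integrableOn_and_integral_div_sq_add_sq_mul {a b : ℝ} (hb : 0 < b) (hab : b < a) :
    IntegrableOn (fun t : ℝ ↦ 4 * t / (t ^ 2 + a ^ 2) * (1 / (b ^ 2 + t ^ 2))) (Set.Ioi 0) ∧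
      ∫ t in Set.Ioi (0 : ℝ), 4 * t / (t ^ 2 + a ^ 2) * (1 / (b ^ 2 + t ^ 2)) =
        4 / (a ^ 2 - b ^ 2) * log (a / b) := by
  have ha : 0 < a := hb.trans hab
  have hsub : a ^ 2 - b ^ 2 ≠ 0 := by nlinarith
  have hd : ∀ t ∈ Set.Ici (0 : ℝ), HasDerivAt
      (fun t ↦ 2 / (a ^ 2 - b ^ 2) * (log (t ^ 2 + b ^ 2) - log (t ^ 2 + a ^ 2)))
      (4 * t / (t ^ 2 + a ^ 2) * (1 / (b ^ 2 + t ^ 2))) t := by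
    intro t _
    have h1 : t ^ 2 + a ^ 2 ≠ 0 := by positivity
    have h2 : t ^ 2 + b ^ 2 ≠ 0 := by positivity
    refine (((((hasDerivAt_pow 2 t).add_const (b ^ 2)).log h2).fun_sub (((hasDerivAt_pow 2 t).add_const
      (a ^ 2)).log h1)).const_mul (2 / (a ^ 2 - b ^ 2))).congr_deriv ?_
    rw [add_comm (b ^ 2)]
    field_simp
    norm_num
    ring
  have hn : ∀ t ∈ Set.Ioi (0 : ℝ), 0 ≤ 4 * t / (t ^ 2 + a ^ 2) * (1 / (b ^ 2 + t ^ 2)) := by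
    intro t ht
    have : 0 < t := ht
    positivity
  have hl : Filter.Tendsto
      (fun t ↦ 2 / (a ^ 2 - b ^ 2) * (log (t ^ 2 + b ^ 2) - log (t ^ 2 + a ^ 2)))
      Filter.atTop (nhds 0) := by
    have h0 : Filter.Tendsto (fun t : ℝ ↦ 1 - (a ^ 2 - b ^ 2) / (t ^ 2 + a ^ 2)) Filter.atTop
        (nhds (1 - 0)) :=
      tendsto_const_nhds.sub ((Filter.tendsto_atTop_add_const_right _ _
        (Filter.tendsto_pow_atTop two_ne_zero)).const_div_atTop _)
    have h1 := (h0.log (by norm_num)).const_mul (2 / (a ^ 2 - b ^ 2))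
    rw [sub_zero, log_one, mul_zero] at h1
    refine h1.congr fun t ↦ ?_
    rw [← log_div (by positivity) (by positivity)]
    congr 2
    field_simp
    ring
  refine ⟨integrableOn_Ioi_deriv_of_nonneg' hd hn hl, ?_⟩
  rw [integral_Ioi_of_hasDerivAt_of_nonneg' hd hn hl, log_div ha.ne' hb.ne']
  simp only [ne_eq, OfNat.ofNat_ne_zero, not_false_eq_true, zero_pow, zero_add, log_pow]
  push_cast
  ring

theorem integral_zero_one_eq_integral_Ioi_exp_neg (g : ℝ → ℝ) :
    ∫ x in (0 : ℝ)..1, g x = ∫ t in Set.Ioi (0 : ℝ), exp (-t) * g (exp (-t)) := by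
  have himage : (fun t : ℝ ↦ exp (-t)) '' Set.Ioi 0 = Set.Ioo 0 1 := by
    ext x
    constructor
    · rintro ⟨t, ht, rfl⟩
      exact ⟨exp_pos _, Real.exp_zero ▸ exp_lt_exp.2 (neg_lt_zero.2 ht)⟩
    · rintro ⟨h0, h1⟩
      exact ⟨-log x, neg_pos.2 (log_neg h0 h1), by simp [exp_log h0]⟩
  rw [intervalIntegral.integral_of_le zero_le_one, integral_Ioc_eq_integral_Ioo, ← himage,
    integral_image_eq_integral_abs_deriv_smul measurableSet_Ioi (f' := fun t ↦ -exp (-t))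
      (fun t _ ↦ by simpa using ((hasDerivAt_neg t).exp).hasDerivWithinAt)
      (fun s _ t _ h ↦ neg_injective (exp_injective h))]
  simp

theorem hasSum_integral_tanh_half_mul {S : ℝ}
    (hS : HasSum (fun n : ℕ ↦ log (2 * n + 3) / (4 * (n + 1) * (n + 2))) S) :
    IntegrableOn (fun t ↦ (1 - exp (-t)) / (1 + exp (-t)) * (1 / (π ^ 2 + t ^ 2))) (Set.Ioi 0) ∧
    ∫ t in Set.Ioi (0 : ℝ), (1 - exp (-t)) / (1 + exp (-t)) * (1 / (π ^ 2 + t ^ 2)) =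
      2 / π ^ 2 + 4 / π ^ 2 * S := by
  set F : ℕ → ℝ → ℝ := fun n t ↦ 4 * t / (t ^ 2 + ((2 * n + 1) * π) ^ 2) * (1 / (π ^ 2 + t ^ 2))
    with hF
  have hpos : ∀ n, ∀ t ∈ Set.Ioi (0 : ℝ), 0 ≤ F n t := by
    intro n t ht
    have : 0 < t := ht
    simp only [hF]
    positivity
  have hsucc : ∀ n : ℕ, IntegrableOn (F (n + 1)) (Set.Ioi 0) ∧ ∫ t in Set.Ioi (0 : ℝ), F (n + 1) t =
      4 / π ^ 2 * (log (2 * n + 3) / (4 * (n + 1) * (n + 2))) := by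
    intro n
    have hlt : π < (2 * ((n + 1 : ℕ) : ℝ) + 1) * π := by
      push_cast
      nlinarith [pi_pos, (Nat.cast_nonneg n : (0:ℝ) ≤ n)]
    obtain ⟨h1, h2⟩ := integrableOn_and_integral_div_sq_add_sq_mul pi_pos hlt
    refine ⟨h1, h2.trans ?_⟩
    rw [mul_div_cancel_right₀ _ pi_ne_zero]
    push_cast
    rw [show 2 * ((n : ℝ) + 1) + 1 = 2 * n + 3 by ring,
      show ((2 * (n : ℝ) + 3) * π) ^ 2 - π ^ 2 = π ^ 2 * (4 * (n + 1) * (n + 2)) by ring]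
    field_simp
  have hzero := integrableOn_and_integral_div_sq_add_sq_sq pi_pos
  have hF0 : F 0 = fun t ↦ 4 * t / (t ^ 2 + π ^ 2) * (1 / (π ^ 2 + t ^ 2)) := by
    funext t
    simp [hF]
  rw [← hF0] at hzero
  have hint : ∀ n, IntegrableOn (F n) (Set.Ioi 0)
    | 0 => hzero.1
    | n + 1 => (hsucc n).1
  have hsum : HasSum (fun n ↦ ∫ t in Set.Ioi (0 : ℝ), F n t) (2 / π ^ 2 + 4 / π ^ 2 * S) := by
    rw [← hasSum_nat_add_iff' 1]
    refine (hS.mul_left (4 / π ^ 2)).congr_terms (fun n ↦ (hsucc n).2) ?_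
    simp [hzero.2]
  have hnorm : ∀ n, ∫ t in Set.Ioi (0 : ℝ), ‖F n t‖ = ∫ t in Set.Ioi (0 : ℝ), F n t := fun n ↦
    setIntegral_congr_fun measurableSet_Ioi fun t ht ↦ norm_of_nonneg (hpos n t ht)
  have hmain := hasSum_integral_of_summable_integral_norm hint
    (by simpa only [hnorm] using hsum.summable)
  have htsum : ∀ t ∈ Set.Ioi (0 : ℝ), ∑' n, F n t =
      (1 - exp (-t)) / (1 + exp (-t)) * (1 / (π ^ 2 + t ^ 2)) := fun t ht ↦
    ((hasSum_tanh_half ht).mul_right _).tsum_eq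
  refine ⟨?_, ?_⟩
  · refine (integrableOn_and_integral_one_div_sq_add_sq pi_pos).1.mono'
      (by fun_prop (disch := intro; positivity)) ?_
    filter_upwards [ae_restrict_mem measurableSet_Ioi] with t ht
    have he : exp (-t) < 1 := Real.exp_zero ▸ exp_lt_exp.2 (neg_lt_zero.2 ht)
    have he' := exp_pos (-t)
    rw [norm_of_nonneg (mul_nonneg (div_nonneg (by linarith) (by linarith)) (by positivity))]
    refine mul_le_of_le_one_left (by positivity) ?_
    rw [div_le_one (by linarith)]
    linarith
  · rw [← setIntegral_congr_fun measurableSet_Ioi htsum]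
    exact hmain.unique hsum

theorem bdh_integral_eight :
    (∫ x in (0:ℝ)..1, 1 / ((π ^ 2 + Real.log x ^ 2) * (1 + x))) =
      1 / 4 - 1 / π ^ 2 -
        (2 / π ^ 2) *
          ∑' k : ℕ,
            (riemannZeta (2 * (k + 1))).re /
              ((2 * ((k : ℝ) + 1) - 1) * 4 ^ (k + 1)) := by
  obtain ⟨h1, h2⟩ := integrableOn_and_integral_one_div_sq_add_sq pi_pos
  obtain ⟨h3, h4⟩ := hasSum_integral_tanh_half_mul hasSum_log_odd_div
  have hsplit : ∀ t : ℝ, exp (-t) * (1 / ((π ^ 2 + log (exp (-t)) ^ 2) * (1 + exp (-t)))) =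
      1 / 2 * (1 / (π ^ 2 + t ^ 2)) -
        1 / 2 * ((1 - exp (-t)) / (1 + exp (-t)) * (1 / (π ^ 2 + t ^ 2))) := by
    intro t
    have := exp_pos (-t)
    rw [log_exp, neg_sq]
    field_simp
    ring
  rw [integral_zero_one_eq_integral_Ioi_exp_neg]
  simp_rw [hsplit]
  rw [integral_sub (h1.const_mul _) (h3.const_mul _), integral_const_mul, integral_const_mul,
    h2, h4]
  field_simp
  ring
end

section
/- The integral ∫₀¹ 1/((4π² + (ln x)²)(1 + x)) dx equals 1/8 − (2/π²) · Σ_{k=1}^∞ ln(2k+1) / ((2k−1)(2k+3)). -/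
open Real MeasureTheory

open Filter Topology Set

/-- The Mittag-Leffler expansion of the hyperbolic cotangent. -/
lemma hasSum_coth {t : ℝ} (ht : 0 < t) :
    HasSum (fun n : ℕ ↦ 2 * t / (t ^ 2 + (((n : ℝ) + 1) * π) ^ 2))
      ((1 + exp (-t) ^ 2) / (1 - exp (-t) ^ 2) - 1 / t) := by
  have hπ := pi_pos
  set z : ℂ := ((t / π : ℝ) : ℂ) * Complex.I with hz
  have hzc : z ∈ Complex.integerComplement := by
    rintro ⟨n, hn⟩
    have := congrArg Complex.im hn
    simp [hz] at this
    exact (div_pos ht hπ).ne this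
  have hs := (summable_cotTerm hzc).hasSum_iff_tendsto_nat.mpr (tendsto_logDeriv_euler_cot_sub hzc)
  have hq : exp (-t) < 1 := by simpa using ht
  have hq0 := exp_pos (-t)
  have hq2 : 1 - exp (-t) ^ 2 ≠ 0 := by nlinarith
  have hcot : Complex.cot (π * z) =
      ((1 + exp (-t) ^ 2 : ℝ) : ℂ) / (Complex.I * ((1 - exp (-t) ^ 2 : ℝ) : ℂ)) := by
    have he : Complex.exp (2 * Complex.I * (π * z)) = ((exp (-t) ^ 2 : ℝ) : ℂ) := by
      rw [← Real.exp_nat_mul, Complex.ofReal_exp]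
      congr 1
      have : (π : ℂ) ≠ 0 := by exact_mod_cast hπ.ne'
      rw [hz]
      push_cast
      field_simp
      rw [Complex.I_sq]
      ring
    rw [Complex.cot_eq_exp_ratio, he]
    push_cast
    ring
  rw [hcot] at hs
  have hs2 := hs.mul_left (Complex.I / π)
  rw [← Complex.hasSum_ofReal]
  have hπc : (π : ℂ) ≠ 0 := by exact_mod_cast hπ.ne'
  have htc : (t : ℂ) ≠ 0 := by exact_mod_cast ht.ne'
  convert! hs2 using 1
  · funext n
    rw [cotTerm_identity hzc, hz]
    have h1 : (t ^ 2 + (((n : ℝ) + 1) * π) ^ 2) ≠ 0 := by positivity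
    have h1c : ((t : ℂ) ^ 2 + (((n : ℂ) + 1) * π) ^ 2) ≠ 0 := by exact_mod_cast h1
    have h2 : ((t / π : ℝ) * Complex.I + ((n : ℂ) + 1)) * ((t / π : ℝ) * Complex.I - ((n : ℂ) + 1))
        = - (((t : ℂ) ^ 2 + (((n : ℂ) + 1) * π) ^ 2) / π ^ 2) := by
      push_cast
      field_simp
      ring_nf
      rw [Complex.I_sq]
      ring
    rw [h2]
    push_cast
    field_simp
    rw [Complex.I_sq]
    ring
  · have h3 : (1 - (exp (-t) : ℂ) ^ 2) ≠ 0 := by exact_mod_cast hq2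
    rw [hz]
    push_cast at h3 ⊢
    field_simp

/-- The Mittag-Leffler expansion of the Fermi-Dirac function `1 / (exp t + 1)`. -/
lemma hasSum_fermi {t : ℝ} (ht : 0 < t) :
    HasSum (fun n : ℕ ↦ 2 * t / (t ^ 2 + ((2 * (n : ℝ) + 1) * π) ^ 2))
      (1 / 2 - exp (-t) / (1 + exp (-t))) := by
  have h := hasSum_coth ht
  have hodd := (hasSum_coth (half_pos ht)).mul_left (1 / 2)
  have hs : Summable (fun n : ℕ ↦ 2 * t / (t ^ 2 + ((2 * (n : ℝ) + 1) * π) ^ 2)) := by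
    have := h.summable.comp_injective (mul_right_injective₀ (two_ne_zero' ℕ))
    simpa [Function.comp_def] using this
  have hsum : HasSum (fun n : ℕ ↦ 2 * t / (t ^ 2 + (((n : ℝ) + 1) * π) ^ 2))
      ((∑' n : ℕ, 2 * t / (t ^ 2 + ((2 * (n : ℝ) + 1) * π) ^ 2)) +
        1 / 2 * ((1 + exp (-(t / 2)) ^ 2) / (1 - exp (-(t / 2)) ^ 2) - 1 / (t / 2))) := by
    refine HasSum.even_add_odd (by simpa using hs.hasSum) ?_
    convert! hodd using 2 with n
    push_cast
    have h1 : t ^ 2 + ((2 * (n : ℝ) + 1 + 1) * π) ^ 2 ≠ 0 := by positivity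
    have h2 : (t / 2) ^ 2 + (((n : ℝ) + 1) * π) ^ 2 ≠ 0 := by positivity
    field_simp
    ring
  have huniq := hsum.unique h
  have hexp : exp (-(t / 2)) ^ 2 = exp (-t) := by
    rw [← Real.exp_nat_mul]
    congr 1
    push_cast
    ring
  rw [hexp] at huniq
  have hq : exp (-t) < 1 := by simpa using ht
  have hq0 := exp_pos (-t)
  have hval : 1 / 2 - exp (-t) / (1 + exp (-t)) = (1 + exp (-t) ^ 2) / (1 - exp (-t) ^ 2) - 1 / t
      - 1 / 2 * ((1 + exp (-t)) / (1 - exp (-t)) - 1 / (t / 2)) := by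
    have h1 : 1 - exp (-t) ≠ 0 := by linarith
    have h2 : 1 + exp (-t) ≠ 0 := by linarith
    have h3 : 1 - exp (-t) ^ 2 = (1 - exp (-t)) * (1 + exp (-t)) := by ring
    rw [h3]
    field_simp
    ring
  rw [hval, ← huniq, add_sub_cancel_right]
  exact hs.hasSum

/-- `arctan (t / a) / a` is a primitive of `1 / (a ^ 2 + t ^ 2)`. -/
lemma hasDerivAt_arctan_div {a : ℝ} (ha : 0 < a) (t : ℝ) :
    HasDerivAt (fun t ↦ arctan (t / a) / a) (1 / (a ^ 2 + t ^ 2)) t := by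
  have h := (((hasDerivAt_id t).div_const a).arctan).div_const a
  refine h.congr_deriv ?_
  have : a ^ 2 + t ^ 2 ≠ 0 := by positivity
  simp only [id]
  field_simp

lemma tendsto_arctan_div {a : ℝ} (ha : 0 < a) :
    Tendsto (fun t ↦ arctan (t / a) / a) atTop (𝓝 (π / 2 / a)) :=
  (((tendsto_arctan_atTop.mono_right nhdsWithin_le_nhds).comp
    (tendsto_id.atTop_div_const ha))).div_const a

lemma integrableOn_one_div_sq_add_sq {a : ℝ} (ha : 0 < a) :
    IntegrableOn (fun t ↦ 1 / (a ^ 2 + t ^ 2)) (Ioi 0) :=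
  integrableOn_Ioi_deriv_of_nonneg' (fun t _ ↦ hasDerivAt_arctan_div ha t)
    (fun t _ ↦ by positivity) (tendsto_arctan_div ha)

lemma integral_one_div_sq_add_sq {a : ℝ} (ha : 0 < a) :
    ∫ t in Ioi 0, 1 / (a ^ 2 + t ^ 2) = π / 2 / a := by
  rw [integral_Ioi_of_hasDerivAt_of_nonneg' (fun t _ ↦ hasDerivAt_arctan_div ha t)
    (fun t _ ↦ by positivity) (tendsto_arctan_div ha)]
  simp

/-- A primitive of `2 t / ((a ^ 2 + t ^ 2) (t ^ 2 + b ^ 2))`. -/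
lemma hasDerivAt_log_div {a b : ℝ} (ha : 0 < a) (hb : 0 < b) (hab : a ≠ b) (t : ℝ) :
    HasDerivAt (fun t ↦ log ((t ^ 2 + a ^ 2) / (t ^ 2 + b ^ 2)) / (b ^ 2 - a ^ 2))
      (1 / (a ^ 2 + t ^ 2) * (2 * t / (t ^ 2 + b ^ 2))) t := by
  have h1 : t ^ 2 + a ^ 2 ≠ 0 := by positivity
  have h1' : a ^ 2 + t ^ 2 ≠ 0 := by positivity
  have h2 : t ^ 2 + b ^ 2 ≠ 0 := by positivity
  have h3 : b ^ 2 - a ^ 2 ≠ 0 := by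
    rw [sq_sub_sq]
    exact mul_ne_zero (by positivity) (sub_ne_zero.mpr hab.symm)
  have hA := ((hasDerivAt_pow 2 t).add_const (a ^ 2))
  have hB := ((hasDerivAt_pow 2 t).add_const (b ^ 2))
  refine (((hA.fun_div hB h2).log (div_ne_zero h1 h2)).div_const _).congr_deriv ?_
  rw [add_comm (a ^ 2)]
  field_simp
  push_cast
  ring

lemma tendsto_log_div (a b : ℝ) :
    Tendsto (fun t : ℝ ↦ log ((t ^ 2 + a ^ 2) / (t ^ 2 + b ^ 2)) / (b ^ 2 - a ^ 2)) atTop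
      (𝓝 0) := by
  have hinv : Tendsto (fun t : ℝ ↦ (t ^ 2)⁻¹) atTop (𝓝 0) :=
    tendsto_inv_atTop_zero.comp (tendsto_pow_atTop two_ne_zero)
  have h : Tendsto (fun t : ℝ ↦ (1 + a ^ 2 * (t ^ 2)⁻¹) / (1 + b ^ 2 * (t ^ 2)⁻¹)) atTop
      (𝓝 ((1 + a ^ 2 * 0) / (1 + b ^ 2 * 0))) :=
    ((hinv.const_mul _).const_add 1).div ((hinv.const_mul _).const_add 1) (by simp)
  have h' := ((h.log (by simp)).div_const (b ^ 2 - a ^ 2))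
  simp only [mul_zero, add_zero, div_one, log_one, zero_div] at h'
  refine h'.congr' ?_
  filter_upwards [eventually_gt_atTop 0] with t ht
  congr 2
  field_simp

lemma integrableOn_mul_div {a b : ℝ} (ha : 0 < a) (hb : 0 < b) (hab : a ≠ b) :
    IntegrableOn (fun t ↦ 1 / (a ^ 2 + t ^ 2) * (2 * t / (t ^ 2 + b ^ 2))) (Ioi 0) :=
  integrableOn_Ioi_deriv_of_nonneg' (fun t _ ↦ hasDerivAt_log_div ha hb hab t)
    (fun t ht ↦ by have : 0 < t := ht; positivity) (tendsto_log_div a b)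

lemma integral_mul_div {a b : ℝ} (ha : 0 < a) (hb : 0 < b) (hab : a ≠ b) :
    ∫ t in Ioi 0, 1 / (a ^ 2 + t ^ 2) * (2 * t / (t ^ 2 + b ^ 2)) =
      2 * log (b / a) / (b ^ 2 - a ^ 2) := by
  rw [integral_Ioi_of_hasDerivAt_of_nonneg' (fun t _ ↦ hasDerivAt_log_div ha hb hab t)
    (fun t ht ↦ by have : 0 < t := ht; positivity) (tendsto_log_div a b)]
  have : ((0 : ℝ) ^ 2 + a ^ 2) / (0 ^ 2 + b ^ 2) = ((b / a) ^ 2)⁻¹ := by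
    field_simp
    ring
  rw [this, log_inv, log_pow]
  push_cast
  ring

/-- The substitution `x = exp (-t)`. -/
lemma integral_zero_one_eq_integral_exp_neg (g : ℝ → ℝ) :
    ∫ x in (0 : ℝ)..1, g x = ∫ t in Ioi 0, exp (-t) * g (exp (-t)) := by
  have himg : (fun t : ℝ ↦ exp (-t)) '' Ioi 0 = Ioo 0 1 := by
    ext x
    constructor
    · rintro ⟨t, ht, rfl⟩
      have : 0 < t := ht
      exact ⟨exp_pos _, by simpa using this⟩
    · rintro ⟨h0, h1⟩
      exact ⟨-log x, by simpa using log_neg h0 h1, by simp [exp_log h0]⟩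
  rw [intervalIntegral.integral_of_le zero_le_one, integral_Ioc_eq_integral_Ioo, ← himg,
    integral_image_eq_integral_abs_deriv_smul (f' := fun t ↦ exp (-t) * (-1)) measurableSet_Ioi
      (fun t _ ↦ (hasDerivAt_neg t).exp.hasDerivWithinAt)
      (fun s _ t _ h ↦ neg_injective (exp_injective h))]
  simp

lemma two_pi_ne_odd_mul_pi (n : ℕ) : 2 * π ≠ (2 * (n : ℝ) + 1) * π := by
  intro h
  have h2 : (2 : ℝ) = 2 * n + 1 := mul_right_cancel₀ pi_ne_zero h
  norm_cast at h2
  omega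

lemma hasSum_log_integrals :
    HasSum (fun n : ℕ ↦ 2 * log ((2 * (n : ℝ) + 1) * π / (2 * π)) /
        (((2 * (n : ℝ) + 1) * π) ^ 2 - (2 * π) ^ 2))
      (1 / 8 - ∫ x in (0:ℝ)..1, 1 / ((4 * π ^ 2 + log x ^ 2) * (1 + x))) := by
  have hπ := pi_pos
  have ha : 0 < 2 * π := by positivity
  set F : ℕ → ℝ → ℝ := fun n t ↦
    1 / ((2 * π) ^ 2 + t ^ 2) * (2 * t / (t ^ 2 + ((2 * (n : ℝ) + 1) * π) ^ 2)) with hF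
  have hFint (n : ℕ) : IntegrableOn (F n) (Ioi 0) :=
    integrableOn_mul_div ha (by positivity) (two_pi_ne_odd_mul_pi n)
  have hFpos (n : ℕ) (t : ℝ) (ht : t ∈ Ioi 0) : 0 ≤ F n t := by
    have : 0 < t := ht
    positivity
  have hFnorm (n : ℕ) : ∫ t in Ioi 0, ‖F n t‖ = ∫ t in Ioi 0, F n t :=
    setIntegral_congr_fun measurableSet_Ioi fun t ht ↦ norm_of_nonneg (hFpos n t ht)
  have hG := (integrableOn_one_div_sq_add_sq ha).const_mul (1 / 2)
  have hFsum (t : ℝ) (ht : t ∈ Ioi 0) : HasSum (fun n ↦ F n t)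
      (1 / ((2 * π) ^ 2 + t ^ 2) * (1 / 2 - exp (-t) / (1 + exp (-t)))) :=
    (hasSum_fermi ht).mul_left _
  have hsummable : Summable fun n ↦ ∫ t in Ioi 0, ‖F n t‖ := by
    simp_rw [hFnorm]
    refine summable_of_sum_range_le (c := ∫ t in Ioi 0, 1 / 2 * (1 / ((2 * π) ^ 2 + t ^ 2)))
      (fun n ↦ setIntegral_nonneg measurableSet_Ioi (hFpos n)) fun N ↦ ?_
    rw [← integral_finsetSum _ fun n _ ↦ hFint n]
    refine setIntegral_mono_on (integrable_finsetSum _ fun n _ ↦ hFint n) hG measurableSet_Ioi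
      fun t ht ↦ (sum_le_hasSum _ (fun n _ ↦ hFpos n t ht) (hFsum t ht)).trans ?_
    rw [mul_comm]
    gcongr
    have := exp_pos (-t)
    simp only [tsub_le_iff_right, le_add_iff_nonneg_right]
    positivity
  have key := hasSum_integral_of_summable_integral_norm hFint hsummable
  convert! key using 1
  · funext n
    rw [← integral_mul_div ha (by positivity) (two_pi_ne_odd_mul_pi n)]
  · have htsum : ∫ t in Ioi 0, ∑' n, F n t = ∫ t in Ioi 0,
        (1 / 2 * (1 / ((2 * π) ^ 2 + t ^ 2)) -
          exp (-t) * (1 / ((4 * π ^ 2 + log (exp (-t)) ^ 2) * (1 + exp (-t))))) := by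
      refine setIntegral_congr_fun measurableSet_Ioi fun t ht ↦ ?_
      rw [(hFsum t ht).tsum_eq, log_exp]
      have := exp_pos (-t)
      have h1 : (2 * π) ^ 2 + t ^ 2 ≠ 0 := by positivity
      have h2 : 4 * π ^ 2 + (-t) ^ 2 = (2 * π) ^ 2 + t ^ 2 := by ring
      rw [h2]
      field_simp
    have hint : IntegrableOn (fun t ↦
        exp (-t) * (1 / ((4 * π ^ 2 + log (exp (-t)) ^ 2) * (1 + exp (-t))))) (Ioi 0) := by
      refine Integrable.mono' (integrableOn_one_div_sq_add_sq ha)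
        (by fun_prop) ?_
      filter_upwards [ae_restrict_mem measurableSet_Ioi] with t ht
      have hq := exp_pos (-t)
      rw [log_exp, norm_of_nonneg (by positivity)]
      have h1 : 0 < (2 * π) ^ 2 + t ^ 2 := by positivity
      have h2 : 4 * π ^ 2 + (-t) ^ 2 = (2 * π) ^ 2 + t ^ 2 := by ring
      rw [h2, mul_one_div, div_le_div_iff₀ (by positivity) h1]
      nlinarith
    rw [integral_zero_one_eq_integral_exp_neg, htsum, integral_sub hG hint, integral_const_mul,
      integral_one_div_sq_add_sq ha]
    congr 1
    field_simp
    norm_num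

/-- A telescoping series: its terms from index `1` on cancel the one at index `0`. -/
lemma hasSum_one_div_odd_mul_odd :
    HasSum (fun n : ℕ ↦ 1 / ((2 * ((n : ℝ) + 1) - 1) * (2 * ((n : ℝ) + 1) + 3))) (1 / 3) := by
  have hpos (n : ℕ) : 0 < 2 * ((n : ℝ) + 1) - 1 := by
    have : (0 : ℝ) ≤ n := n.cast_nonneg
    linarith
  rw [hasSum_iff_tendsto_nat_of_nonneg fun n ↦ by have := hpos n; positivity]
  have hsum (N : ℕ) : ∑ n ∈ Finset.range N,
      1 / ((2 * ((n : ℝ) + 1) - 1) * (2 * ((n : ℝ) + 1) + 3)) =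
      1 / 3 - 1 / 4 * (1 / (2 * (N : ℝ) + 1)) - 1 / 4 * (1 / (2 * (N : ℝ) + 3)) := by
    induction N with
    | zero => norm_num
    | succ N ih =>
      rw [Finset.sum_range_succ, ih]
      have h := (hpos N).ne'
      have h2 : 2 * ((N : ℝ) + 1) - 1 = 2 * N + 1 := by ring
      rw [h2]
      push_cast
      field_simp
      ring
  simp_rw [hsum]
  have hlim (c : ℝ) : Tendsto (fun N : ℕ ↦ 1 / 4 * (1 / (2 * (N : ℝ) + c))) atTop (𝓝 0) := by
    have : Tendsto (fun N : ℕ ↦ 2 * (N : ℝ) + c) atTop atTop :=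
      tendsto_atTop_add_const_right _ _
        (tendsto_natCast_atTop_atTop.const_mul_atTop two_pos)
    simpa using (this.inv_tendsto_atTop).const_mul (1 / 4 : ℝ)
  simpa only [sub_zero] using ((hlim 1).const_sub (1 / 3)).sub (hlim 3)

theorem bdh_integral_nine :
    (∫ x in (0:ℝ)..1, 1 / ((4 * π ^ 2 + Real.log x ^ 2) * (1 + x))) =
      1 / 8 -
        (2 / π ^ 2) *
          ∑' k : ℕ,
            Real.log (2 * ((k : ℝ) + 1) + 1) /
              ((2 * ((k : ℝ) + 1) - 1) * (2 * ((k : ℝ) + 1) + 3)) := by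
  have hπ := pi_pos
  have h := (hasSum_nat_add_iff' 1).mpr hasSum_log_integrals
  have h2 := (h.mul_left (π ^ 2 / 2)).add (hasSum_one_div_odd_mul_odd.mul_left (log 2))
  have hterm : (fun k : ℕ ↦ Real.log (2 * ((k : ℝ) + 1) + 1) /
      ((2 * ((k : ℝ) + 1) - 1) * (2 * ((k : ℝ) + 1) + 3))) = fun k : ℕ ↦
      π ^ 2 / 2 * (2 * log ((2 * ((k + 1 : ℕ) : ℝ) + 1) * π / (2 * π)) /
        (((2 * ((k + 1 : ℕ) : ℝ) + 1) * π) ^ 2 - (2 * π) ^ 2)) +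
      log 2 * (1 / ((2 * ((k : ℝ) + 1) - 1) * (2 * ((k : ℝ) + 1) + 3))) := by
    funext k
    have h1 : 2 * ((k : ℝ) + 1) - 1 ≠ 0 := by
      have : (0 : ℝ) ≤ k := k.cast_nonneg
      linarith
    have h3 : ((2 * ((k : ℝ) + 1) + 1) * π) ^ 2 - (2 * π) ^ 2 =
        π ^ 2 * ((2 * ((k : ℝ) + 1) - 1) * (2 * ((k : ℝ) + 1) + 3)) := by ring
    push_cast
    rw [h3, mul_div_mul_right _ _ hπ.ne', log_div (by positivity) two_ne_zero]
    field_simp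
    ring
  rw [hterm, h2.tsum_eq, Finset.sum_range_one]
  have h0 : log ((2 * ((0 : ℕ) : ℝ) + 1) * π / (2 * π)) = -log 2 := by
    rw [mul_div_mul_right _ _ hπ.ne']
    simp
  have h4 : ((2 * ((0 : ℕ) : ℝ) + 1) * π) ^ 2 - (2 * π) ^ 2 = -(3 * π ^ 2) := by
    push_cast
    ring
  rw [h0, h4]
  field_simp
  ring
end
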